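/- arXiv:1902.01166 — 6 statements merged into one kernel-verified Lean document; each statement's English description precedes it below -/
import Mathlib

section
/- For every integer k ≥ 1, the polynomial G_k satisfies the Rodrigues-type identity X²(1−X)²·G_k = (−1)^{k−1}·((k+3)!/(2k+2)!)·D^{k−1}(X^{k+1}(1−X)^{k+1}), where D^{k−1} denotes the (k−1)-fold formal derivative of polynomials. -/
open Polynomial

/-- The Jacobi-type polynomial sequence: G 1 = 1, G 2 = X - 1/2, and for k ≥ 3,
    G k = (X - 1/2)·G (k-1) - ((k-2)(k+2)/(4(2k-1)(2k+1)))·G (k-2). -/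
noncomputable def G : ℕ → Polynomial ℝ
  | 0 => 0
  | 1 => 1
  | 2 => Polynomial.X - Polynomial.C (1/2)
  | (k+3) =>
      (Polynomial.X - Polynomial.C (1/2)) * G (k+2)
        - Polynomial.C ((((k:ℝ)+1)*((k:ℝ)+5))/(4*(2*(k:ℝ)+5)*(2*(k:ℝ)+7))) * G (k+1)

theorem rod_leib (f : Polynomial ℝ) (n : ℕ) :
    derivative^[n+1] ((1 - 2 * X) * f) =
      (1 - 2 * X) * derivative^[n+1] f - 2 * ((n : Polynomial ℝ) + 1) * derivative^[n] f := by
  induction n with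
  | zero => simp [derivative_mul]; ring
  | succ n ih =>
    rw [Function.iterate_succ_apply', ih, Function.iterate_succ_apply' _ (n+1) f,
      Function.iterate_succ_apply' _ n f]
    simp [derivative_mul]
    ring

theorem rod_d1 (p : ℕ) :
    derivative ((X * (1 - X) : Polynomial ℝ)^(p+1)) =
      C ((p:ℝ) + 1) * ((1 - 2 * X) * (X * (1 - X))^p) := by
  rw [derivative_pow]
  simp [derivative_mul]
  ring

theorem rod_d2 (p : ℕ) :
    derivative (derivative ((X * (1 - X) : Polynomial ℝ)^(p+2))) =
      C (((p:ℝ) + 2) * (p + 1)) * (X * (1 - X))^p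
        - C (2 * ((p:ℝ) + 2) * (2 * p + 3)) * (X * (1 - X))^(p+1) := by
  rw [rod_d1 (p+1), derivative_C_mul, derivative_mul, rod_d1 p]
  simp [show (C 2 : Polynomial ℝ) = 2 from rfl, show (C 3 : Polynomial ℝ) = 3 from rfl]
  ring

/-- the derivatives -/
noncomputable def rodR (n : ℕ) : Polynomial ℝ := derivative^[n] ((X * (1 - X))^(n+2))

theorem rod_rec (n : ℕ) :
    C ((n:ℝ) + 6) * rodR (n+2) = C ((2 * (n:ℝ) + 7) * (n + 4)) * ((1 - 2 * X) * rodR (n+1))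
      - C (((n:ℝ) + 1) * (n + 3) * (n + 4)) * rodR n := by
  have h1 : rodR (n+2) = C (((n:ℝ) + 4) * (n + 3)) * rodR n
      - C (2 * ((n:ℝ) + 4) * (2 * n + 7)) * derivative^[n] ((X * (1 - X))^(n+3)) := by
    unfold rodR
    rw [Function.iterate_add_apply _ n 2]
    simp only [Function.iterate_succ, Function.iterate_zero, Function.comp, id]
    rw [rod_d2 (n+2), iterate_derivative_sub, iterate_derivative_C_mul, iterate_derivative_C_mul]
    push_cast
    congr 3 <;> ring_nf
  have h2 : rodR (n+2) = C ((n:ℝ) + 4) * ((1 - 2 * X) * rodR (n+1)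
      - 2 * ((n : Polynomial ℝ) + 1) * derivative^[n] ((X * (1 - X))^(n+3))) := by
    unfold rodR
    rw [← rod_leib, Function.iterate_succ_apply, rod_d1 (n+3), iterate_derivative_C_mul]
    push_cast
    congr 2
    ring_nf
  simp only [map_add, map_mul, map_natCast, map_ofNat, map_one] at h1 h2 ⊢
  linear_combination (2 * (n : Polynomial ℝ) + 7) * h2 - ((n : Polynomial ℝ) + 1) * h1

/-- the constants -/
noncomputable def rodc (n : ℕ) : ℝ :=
  (-1:ℝ)^n * (Nat.factorial (n+4) : ℝ) / (Nat.factorial (2*n+4) : ℝ)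

theorem rodc_succ (n : ℕ) :
    rodc n * ((n:ℝ) + 5) = - rodc (n+1) * ((2 * n + 5) * (2 * n + 6)) := by
  unfold rodc
  have e : 2 * (n+1) + 4 = (2*n+4) + 1 + 1 := by ring
  have e' : n + 1 + 4 = (n + 4) + 1 := by ring
  have h : (Nat.factorial (2*n+4) : ℝ) ≠ 0 := by positivity
  have h1 : 2 * (n:ℝ) + 5 ≠ 0 := by positivity
  have h2 : 2 * (n:ℝ) + 6 ≠ 0 := by positivity
  rw [e, e', Nat.factorial_succ (2*n+4+1), Nat.factorial_succ (2*n+4), Nat.factorial_succ (n+4), pow_succ]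
  push_cast
  have h3 : 2 * (n:ℝ) + 4 + 1 ≠ 0 := by positivity
  have h4 : 2 * (n:ℝ) + 4 + 1 + 1 ≠ 0 := by positivity
  field_simp
  ring

theorem rod_key (n : ℕ) : C (rodc (n+2)) * rodR (n+2) =
    (X - C (1/2)) * (C (rodc (n+1)) * rodR (n+1)) -
     C ((((n:ℝ)+1)*((n:ℝ)+5))/(4*(2*(n:ℝ)+5)*(2*(n:ℝ)+7))) * (C (rodc n) * rodR n) := by
  have h6 : (n:ℝ) + 6 ≠ 0 := by positivity
  have h5 : (n:ℝ) + 5 ≠ 0 := by positivity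
  have a1 : 2 * (n:ℝ) + 5 ≠ 0 := by positivity
  have a2 : 2 * (n:ℝ) + 7 ≠ 0 := by positivity
  have a3 : (n:ℝ) + 4 ≠ 0 := by positivity
  have c1 := rodc_succ n
  have c2 := rodc_succ (n+1)
  push_cast at c2
  have e1 : rodc (n+1) = - (2 * ((2 * (n:ℝ) + 7) * (n + 4)) * (rodc (n+2) / (n+6))) := by
    field_simp
    linear_combination c2
  have e0 : (((n:ℝ)+1)*((n:ℝ)+5))/(4*(2*(n:ℝ)+5)*(2*(n:ℝ)+7)) * rodc n
      = (rodc (n+2) / (n+6)) * (((n:ℝ) + 1) * (n + 3) * (n + 4)) := by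
    have : rodc n = - rodc (n+1) * ((2 * n + 5) * (2 * n + 6)) / (n+5) := by
      field_simp
      linear_combination c1
    rw [this, e1]
    field_simp
    ring
  have e2 : rodc (n+2) = (rodc (n+2) / (n+6)) * ((n:ℝ) + 6) := by field_simp
  have r := rod_rec n
  rw [← mul_assoc (C _) (C _) (rodR n), ← C_mul, e0, e1, e2]
  generalize rodc (n+2) / ((n:ℝ)+6) = t
  have hh : (C (1/2) : Polynomial ℝ) * 2 = 1 := by
    rw [show (2 : Polynomial ℝ) = C 2 from rfl, ← C_mul]; norm_num
  have e3 : t * ((n:ℝ) + 6) / ((n:ℝ)+6) = t := by field_simp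
  simp only [e3]
  rw [C_mul (a := t), C_mul (a := t), C_neg, C_mul (b := t), C_mul (a := 2), show (C 2 : Polynomial ℝ) = 2 from rfl]
  linear_combination C t * r - C ((2 * (n:ℝ) + 7) * (n + 4)) * C t * rodR (n+1) * hh

theorem rod_main (n : ℕ) :
    X^2 * (1 - X)^2 * G (n+1) = C (rodc n) * rodR n ∧
    X^2 * (1 - X)^2 * G (n+2) = C (rodc (n+1)) * rodR (n+1) := by
  induction n with
  | zero =>
    constructor
    · simp [G, rodc, rodR, mul_pow, Nat.factorial]
    · have : rodc 1 = -(1/6) := by simp [rodc, Nat.factorial]; norm_num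
      have h3 : (C (-(1/6)) : Polynomial ℝ) * C 3 = - C (1/2) := by
        rw [← C_mul, ← C_neg]; norm_num
      have hh : (C (1/2) : Polynomial ℝ) * 2 = 1 := by
        rw [show (2 : Polynomial ℝ) = C 2 from rfl, ← C_mul]; norm_num
      have hR : rodR 1 = C 3 * ((1 - 2 * X) * (X * (1 - X))^2) := by
        have := rod_d1 2
        norm_num at this
        simpa [rodR] using this
      rw [zero_add, zero_add, this, hR, ← mul_assoc, h3]
      simp only [G]
      linear_combination -X^3 * (1-X)^2 * hh
  | succ n ih =>
    refine ⟨ih.2, ?_⟩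
    rw [rod_key, ← ih.1, ← ih.2]
    show X^2 * (1 - X)^2 * G (n+3) = _
    rw [G]
    ring

/-- Rodrigues-type identity for G_k. -/
theorem G_rodrigues (k : ℕ) (hk : 1 ≤ k) :
    Polynomial.X^2 * (1 - Polynomial.X)^2 * G k =
      Polynomial.C ((-1:ℝ)^(k-1) * (Nat.factorial (k+3) : ℝ) / (Nat.factorial (2*k+2) : ℝ))
        * (Polynomial.derivative^[k-1] (Polynomial.X^(k+1) * (1 - Polynomial.X)^(k+1))) := by
  obtain ⟨n, rfl⟩ : ∃ n, k = n + 1 := ⟨k - 1, by omega⟩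
  have h := (rod_main n).1
  rw [h, rodc, rodR, mul_pow]
  rfl
end

section
/- For all integers k, j ≥ 1 with k ≠ j, the weighted orthogonality ∫₀¹ x²(1−x)²·G_k(x)·G_j(x) dx = 0 holds. -/
open Polynomial

lemma G_rec (n : ℕ) (x : ℝ) : (G (n+2)).eval x = (x - 1/2) * (G (n+1)).eval x
    - ((n:ℝ)*(n+4)/(4*(2*n+3)*(2*n+5))) * (G n).eval x := by
  rcases n with _ | n
  · simp [G]
  · rw [show n+1+2 = n+3 from rfl, G]
    simp only [eval_sub, eval_mul, eval_X, eval_C]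
    push_cast
    ring_nf

lemma G_rec' (n : ℕ) (x : ℝ) : (derivative (G (n+2))).eval x = (G (n+1)).eval x
    + (x - 1/2) * (derivative (G (n+1))).eval x
    - ((n:ℝ)*(n+4)/(4*(2*n+3)*(2*n+5))) * (derivative (G n)).eval x := by
  rcases n with _ | n
  · simp [G]
  · rw [show n+1+2 = n+3 from rfl, G]
    simp only [derivative_sub, derivative_mul, derivative_X, derivative_C,
      eval_sub, eval_add, eval_mul, eval_X, eval_C, eval_one, eval_zero]
    push_cast
    ring_nf

lemma G_B (x : ℝ) (n : ℕ) : x*(1-x) * (derivative (G (n+1))).eval x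
    = (n+5) * (x-1/2) * (G (n+1)).eval x - (2*n+5) * (G (n+2)).eval x := by
  induction n using Nat.twoStepInduction with
  | zero => simp [G]
  | one =>
    rw [G_rec 1]
    simp [G]
    ring
  | more n h0 h1 =>
    have r3 := G_rec (n+2) x
    have r2 := G_rec (n+1) x
    have d := G_rec' (n+1) x
    push_cast at *
    have e : ((n:ℝ)+1)*(n+1+4)/(4*(2*(n+1)+3)*(2*(n+1)+5)) * (4*(2*n+5)*(2*n+7)) = (n+1)*(n+5) := by
      field_simp
      ring
    have e2 : ((n:ℝ)+2)*(n+2+4)/(4*(2*(n+2)+3)*(2*(n+2)+5)) * (4*(2*n+7)*(2*n+9)) = (n+2)*(n+6) := by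
      field_simp
      ring
    set a := ((n:ℝ)+1)*(n+1+4)/(4*(2*(n+1)+3)*(2*(n+1)+5))
    set b := ((n:ℝ)+2)*(n+2+4)/(4*(2*(n+2)+3)*(2*(n+2)+5))
    rw [show n+1+2 = n+3 from rfl, show n+1+1 = n+2 from rfl] at *
    rw [show n+2+2 = n+4 from rfl, show n+2+1 = n+3 from rfl] at *
    have hp : (2*(n:ℝ)+7) ≠ 0 := by positivity
    have ea : (2*(n:ℝ)+5)*a = (n+1)*(n+5)/(4*(2*n+7)) := by
      field_simp
      linarith
    have eb : (2*(n:ℝ)+9)*b = (n+2)*(n+6)/(4*(2*n+7)) := by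
      field_simp
      linarith
    have eab : (2*(n:ℝ)+9)*b = (2*(n:ℝ)+5)*a + 1/4 := by
      rw [ea, eb]
      field_simp
      ring
    linear_combination (x*(1-x)) * d + (x-1/2)*h1 - a * h0 + (2*n+9)*r3 - (G (n+2)).eval x * eab
      + ((n:ℝ)-(2*n+9)+4) * (x-1/2) * r2

lemma G_A (n : ℕ) : (X*(1-X)) * derivative (G (n+2))
    = C (-((n:ℝ)+1)) * (X - C (1/2)) * G (n+2) + C (((n:ℝ)+1)*(n+5)/(4*(2*n+5))) * G (n+1) := by
  apply Polynomial.funext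
  intro x
  have r3 := G_rec (n+1) x
  have h := G_B x (n+1)
  simp only [eval_sub, eval_add, eval_mul, eval_X, eval_C, eval_one]
  push_cast at *
  rw [show n+1+2 = n+3 from rfl, show n+1+1 = n+2 from rfl] at *
  have e : (2*(n:ℝ)+7) * (((n:ℝ)+1)*(n+1+4)/(4*(2*(n+1)+3)*(2*(n+1)+5))) = ((n:ℝ)+1)*(n+5)/(4*(2*n+5)) := by
    field_simp
    ring
  linear_combination h - (2*n+7)*r3 + (G (n+1)).eval x * e

lemma G_ode (x : ℝ) (n : ℕ) : x*(1-x)*(x*(1-x) * (derivative (derivative (G (n+1)))).eval x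
    + 3*(1-2*x) * (derivative (G (n+1))).eval x + n*(n+5) * (G (n+1)).eval x) = 0 := by
  rcases n with _ | n
  · simp [G]
  have a := congrArg (eval x) (G_A n)
  have d := congrArg (fun p => eval x (derivative p)) (G_A n)
  have b := G_B x n
  simp only [derivative_sub, derivative_add, derivative_mul, derivative_X, derivative_C, derivative_one,
      eval_sub, eval_add, eval_mul, eval_X, eval_C, eval_one, eval_zero] at a d
  push_cast
  rw [show n+1+1 = n+2 from rfl] at *
  have e : (((n:ℝ)+1)*(n+5)/(4*(2*n+5))) * (2*n+5) = (n+1)*(n+5)/4 := by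
    field_simp
  set c := (((n:ℝ)+1)*(n+5)/(4*(2*n+5)))
  linear_combination (x*(1-x)) * d + c * b - (G (n+2)).eval x * e - (n+5) * (x-1/2) * a

/-- Weighted orthogonality of the G_k. -/
theorem G_orthogonal (k j : ℕ) (hk : 1 ≤ k) (hj : 1 ≤ j) (hkj : k ≠ j) :
    (∫ x in (0:ℝ)..1, x^2 * (1-x)^2 * (G k).eval x * (G j).eval x) = 0 := by
  obtain ⟨n, rfl⟩ := Nat.exists_eq_add_of_le' hk
  obtain ⟨m, rfl⟩ := Nat.exists_eq_add_of_le' hj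
  have hne : ((m:ℝ)*(m+5) - n*(n+5)) ≠ 0 := by
    have h1 : (m:ℝ) - n ≠ 0 := by
      rw [sub_ne_zero]
      norm_cast
      omega
    have h2 : (m:ℝ) + n + 5 ≠ 0 := by positivity
    have := mul_ne_zero h1 h2
    intro h
    apply this
    linarith
  set P := G (n+1) with hP
  set R := G (m+1) with hR
  let F : ℝ[X] := (X*(1-X))^3 * (derivative P * R - P * derivative R)
  have hF : ∀ x : ℝ, HasDerivAt (fun x => F.eval x)
      (((m:ℝ)*(m+5) - n*(n+5)) * (x^2 * (1-x)^2 * P.eval x * R.eval x)) x := by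
    intro x
    refine HasDerivAt.congr_deriv (F.hasDerivAt x) (Eq.symm ?_)
    have h1 := G_ode x n
    have h2 := G_ode x m
    rw [← hP] at h1
    rw [← hR] at h2
    simp only [F, derivative_pow, derivative_sub, derivative_mul, derivative_X, derivative_one,
      eval_sub, eval_add, eval_mul, eval_pow, eval_X, eval_one, eval_zero, eval_C]
    push_cast
    linear_combination (-x*(1-x)*R.eval x) * h1 + (x*(1-x)*P.eval x) * h2
  have hI := intervalIntegral.integral_eq_sub_of_hasDerivAt (a := 0) (b := 1) (fun x _ => hF x)
    (Continuous.intervalIntegrable (by fun_prop) _ _)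
  rw [intervalIntegral.integral_const_mul] at hI
  have h0 : F.eval 1 - F.eval 0 = 0 := by simp [F]
  rw [h0] at hI
  exact (mul_eq_zero.mp hI).resolve_left hne
end

section
/- For every integer k ≥ 1, ∫₀¹ x²(1−x)²·G_k(x)² dx = (k−1)!·((k+1)!)²·(k+3)! / ((2k+2)!·(2k+3)!). -/
open Polynomial

noncomputable def gam (n : ℕ) : ℝ := ((n:ℝ)*((n:ℝ)+4))/(4*(2*(n:ℝ)+3)*(2*(n:ℝ)+5))

noncomputable def LL (p : Polynomial ℝ) : ℝ := ∫ x in (0:ℝ)..1, x^2 * (1-x)^2 * p.eval x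

lemma LL_int (p : Polynomial ℝ) :
    IntervalIntegrable (fun x : ℝ => x^2 * (1-x)^2 * p.eval x) MeasureTheory.volume 0 1 := by
  apply Continuous.intervalIntegrable
  have := p.continuous
  fun_prop

lemma LL_add (p q : Polynomial ℝ) : LL (p + q) = LL p + LL q := by
  unfold LL
  rw [← intervalIntegral.integral_add (LL_int p) (LL_int q)]
  congr 1; funext x; rw [eval_add]; ring

lemma LL_C (c : ℝ) (p : Polynomial ℝ) : LL (C c * p) = c * LL p := by
  unfold LL
  rw [← intervalIntegral.integral_const_mul]
  congr 1; funext x; rw [eval_mul, eval_C]; ring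

lemma LL_parts (p : Polynomial ℝ) :
    LL (3 * (1 - 2 * X) * p + X * (1 - X) * derivative p) = 0 := by
  have h : ∀ x ∈ Set.uIcc (0:ℝ) 1, HasDerivAt (fun x : ℝ => ((X * (1 - X))^3 * p : Polynomial ℝ).eval x)
      (x^2 * (1-x)^2 * (3 * (1 - 2 * X) * p + X * (1 - X) * derivative p : Polynomial ℝ).eval x) x := by
    intro x _
    have := ((X * (1 - X))^3 * p : Polynomial ℝ).hasDerivAt x
    refine this.congr_deriv ?_
    simp [derivative_pow]
    ring
  unfold LL
  rw [intervalIntegral.integral_eq_sub_of_hasDerivAt h (LL_int _)]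
  simp

lemma P_rec (n : ℕ) : G (n+3) = (X - C (1/2)) * G (n+2) - C (gam (n+1)) * G (n+1) := by
  rw [G, gam]; push_cast
  congr 4 <;> ring

lemma P_mul (n : ℕ) : (X - C (1/2)) * G (n+2) = G (n+3) + C (gam (n+1)) * G (n+1) := by
  rw [P_rec]; ring

lemma G2 : G 2 = X - C (1/2) := by rw [G]
lemma G1 : G 1 = 1 := by rw [G]

lemma struct (n : ℕ) (x : ℝ) : x * (1 - x) * (derivative (G (n+2))).eval x
    = -((n:ℝ)+1) * (x - 1/2) * (G (n+2)).eval x + gam (n+1) * (2*n+7) * (G (n+1)).eval x := by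
  induction n using Nat.twoStepInduction with
  | zero => simp [G2, G1, gam]; ring
  | one =>
    rw [P_rec]; simp [G2, G1, gam]; ring
  | more n h0 h1 =>
    have e : (G (n+4)).eval x = (x - 1/2) * (G (n+3)).eval x - gam (n+2) * (G (n+2)).eval x := by
      rw [P_rec]; simp
    have e0 : (G (n+3)).eval x = (x - 1/2) * (G (n+2)).eval x - gam (n+1) * (G (n+1)).eval x := by
      rw [P_rec]; simp
    have d : (derivative (G (n+4))).eval x = (G (n+3)).eval x
        + (x - 1/2) * (derivative (G (n+3))).eval x - gam (n+2) * (derivative (G (n+2))).eval x := by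
      rw [P_rec]; simp
    have g : gam (n+3) * (2*n+11) = 1/4 + gam (n+2) * (2*n+7) := by
      unfold gam; push_cast; field_simp; ring
    push_cast at h1 ⊢
    show x * (1 - x) * (derivative (G (n+4))).eval x = -((n:ℝ)+2+1) * (x - 1/2) * (G (n+4)).eval x
      + gam (n+3) * (2*(n+2)+7) * (G (n+3)).eval x
    change x * (1 - x) * (derivative (G (n+3))).eval x = -((n:ℝ)+1+1) * (x - 1/2) * (G (n+3)).eval x
      + gam (n+2) * (2*(n+1)+7) * (G (n+2)).eval x at h1
    rw [d, e]
    linear_combination (x-1/2) * h1 - gam (n+2) * h0 - (G (n+3)).eval x * g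
      - gam (n+2) * (2*n+7) * e0

lemma LL_rec (n : ℕ) : ((n:ℝ)+7) * LL (G (n+3)) = n * gam (n+1) * LL (G (n+1)) := by
  have h := LL_parts (G (n+2))
  have : (3 * (1 - 2 * X) * G (n+2) + X * (1 - X) * derivative (G (n+2)) : Polynomial ℝ)
      = C (-((n:ℝ)+7)) * G (n+3) + C (n * gam (n+1)) * G (n+1) := by
    apply Polynomial.funext
    intro x
    have s := struct n x
    have e0 : (G (n+3)).eval x = (x - 1/2) * (G (n+2)).eval x - gam (n+1) * (G (n+1)).eval x := by
      rw [P_rec]; simp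
    simp only [eval_add, eval_mul, eval_sub, eval_X, eval_C, eval_one, eval_ofNat]
    linear_combination s + (n+7) * e0
  rw [this, LL_add, LL_C, LL_C] at h
  linarith

lemma LL_zero (n : ℕ) : LL (G (n+2)) = 0 := by
  induction n using Nat.twoStepInduction with
  | zero =>
    have h := LL_parts (G 1)
    have : (3 * (1 - 2 * X) * G 1 + X * (1 - X) * derivative (G 1) : Polynomial ℝ)
      = C (-6) * G 2 := by
      apply Polynomial.funext
      intro x
      simp [G1, G2]; ring
    rw [this, LL_C] at h
    simpa using h
  | one =>
    have := LL_rec 0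
    simpa using this
  | more n h0 h1 =>
    have := LL_rec (n+1)
    rw [show n + 1 + 1 = n + 2 from rfl, h0, mul_zero] at this
    have h7 : (((n+1:ℕ):ℝ)+7) ≠ 0 := by positivity
    exact (mul_eq_zero.mp this).resolve_left h7

lemma orth (m : ℕ) : ∀ n, m < n → LL (G (m+1) * G (n+1)) = 0 := by
  induction m using Nat.twoStepInduction with
  | zero =>
    intro n hn
    obtain ⟨j, rfl⟩ := Nat.exists_eq_add_of_lt hn
    rw [G1, one_mul, show 0 + j + 1 + 1 = j + 2 by ring]
    exact LL_zero j
  | one =>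
    intro n hn
    obtain ⟨j, rfl⟩ := Nat.exists_eq_add_of_lt hn
    rw [show 1 + 1 = 2 from rfl, show 1 + j + 1 + 1 = (j+1) + 2 by ring, G2, P_mul, LL_add, LL_C,
      show j + 1 + 3 = (j+2)+2 by ring, LL_zero, show j + 1 + 1 = j + 2 by ring, LL_zero]
    simp
  | more m h0 h1 =>
    intro n hn
    obtain ⟨j, rfl⟩ := Nat.exists_eq_add_of_lt hn
    have e : G (m+2+1) * G (m+2+j+1+1) = G (m+1+1) * G ((m+2+j+1+1)+1)
        + (C (gam (m+2+j+1)) * (G (m+1+1) * G ((m+2+j)+1))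
        + C (-gam (m+1)) * (G (m+1) * G ((m+2+j+1)+1))) := by
      have a := P_mul (m+2+j)
      have b := P_rec m
      rw [C_neg]
      linear_combination G (m+2+j+2) * b + G (m+2) * a
    rw [e, LL_add, LL_add, LL_C, LL_C, h1 _ (by omega), h1 _ (by omega), h0 _ (by omega)]
    simp

lemma hrec (n : ℕ) : LL (G (n+2) * G (n+2)) = gam (n+1) * LL (G (n+1) * G (n+1)) := by
  rcases n with _ | n
  · have e : G 2 * G 2 = G (1+2) + C (gam 1) * (G 1 * G 1) := by
      have a := P_mul 0
      rw [← G2] at a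
      rw [G1, mul_one]
      simpa [G1] using a
    rw [show 0 + 2 = 2 from rfl, e, LL_add, LL_C, LL_zero]
    simp
  · have e : G (n+3) * G (n+3) = G ((n+1)+1) * G ((n+3)+1)
        + (C (gam (n+2)) * (G (n+2) * G (n+2)) + C (-gam (n+1)) * (G (n+1) * G ((n+2)+1))) := by
      have a := P_mul (n+1)
      have b := P_rec n
      rw [C_neg]
      linear_combination G (n+3) * b + G (n+2) * a
    rw [show n + 1 + 2 = n + 3 from rfl, e, LL_add, LL_add, LL_C, LL_C, orth (n+1) (n+3) (by omega),
      orth n (n+2) (by omega)]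
    simp

lemma norm_aux (n : ℕ) : LL (G (n+1) * G (n+1))
      = (Nat.factorial n : ℝ) * ((Nat.factorial (n+2) : ℝ))^2 * (Nat.factorial (n+4) : ℝ)
          / ((Nat.factorial (2*n+4) : ℝ) * (Nat.factorial (2*n+5) : ℝ)) := by
  induction n with
  | zero =>
    have : LL (G 1 * G 1) = 1/30 := by
      have : (fun x : ℝ => x^2 * (1-x)^2 * (G 1 * G 1).eval x) = fun x => x^2 - 2 * x^3 + x^4 := by
        funext x; simp [G1]; ring
      unfold LL
      rw [this, intervalIntegral.integral_add, intervalIntegral.integral_sub]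
      · simp; norm_num
      all_goals apply Continuous.intervalIntegrable; fun_prop
    rw [this]; norm_num [Nat.factorial]
  | succ n ih =>
    rw [show n + 1 + 1 = n + 2 from rfl, hrec, ih, gam]
    rw [show 2*(n+1)+4 = 2*n+4+1+1 by ring, show 2*(n+1)+5 = 2*n+5+1+1 by ring,
      show n+1+2 = (n+2)+1 by ring, show n+1+4 = (n+4)+1 by ring]
    simp only [Nat.factorial_succ (n+4), Nat.factorial_succ (n+2), Nat.factorial_succ n,
      Nat.factorial_succ (2*n+4+1), Nat.factorial_succ (2*n+4),
      Nat.factorial_succ (2*n+5+1), Nat.factorial_succ (2*n+5)]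
    have h1 : (Nat.factorial (2*n+4) : ℝ) ≠ 0 := by positivity
    have h2 : (Nat.factorial (2*n+5) : ℝ) ≠ 0 := by positivity
    generalize Nat.factorial (2*n+4) = A at *
    generalize Nat.factorial (2*n+5) = B at *
    generalize Nat.factorial (n+4) = D at *
    generalize Nat.factorial (n+2) = E at *
    generalize Nat.factorial n = F at *
    push_cast
    field_simp
    ring

/-- Weighted norm of G_k. -/
theorem G_norm (k : ℕ) (hk : 1 ≤ k) :
    (∫ x in (0:ℝ)..1, x^2 * (1-x)^2 * ((G k).eval x)^2)
      = (Nat.factorial (k-1) : ℝ) * ((Nat.factorial (k+1) : ℝ))^2 * (Nat.factorial (k+3) : ℝ)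
          / ((Nat.factorial (2*k+2) : ℝ) * (Nat.factorial (2*k+3) : ℝ)) := by
  obtain ⟨n, rfl⟩ := Nat.exists_eq_add_of_le' hk
  have h := norm_aux n
  unfold LL at h
  simp only [← pow_two, eval_pow] at h
  rw [h]
  rfl
end

section
/- For every integer k ≥ 1, ∫₀¹ x·ψ_k(x) dx = 1. -/
open Polynomial

/-- ψ_k = ((2k+2)!/((k−1)!·(k+1)!))·X(1−X)·G_k. -/
noncomputable def psi (k : ℕ) : Polynomial ℝ :=
  Polynomial.C ((Nat.factorial (2*k+2) : ℝ) /
      ((Nat.factorial (k-1) : ℝ) * (Nat.factorial (k+1) : ℝ)))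
    * (Polynomial.X * (1 - Polynomial.X)) * G k

noncomputable def NI (n j : ℕ) : ℝ :=
  ∫ x in (0:ℝ)..1, x^2 * (1-x)^(j+1) * (G (n+1)).eval x

noncomputable def PP (n j : ℕ) : ℝ := ∏ i ∈ Finset.range n, ((j:ℝ) - 1 - i)

lemma PP_succ (n j : ℕ) : PP (n+1) j = PP n j * ((j:ℝ) - 1 - n) := by
  simp [PP, Finset.prod_range_succ]

lemma PP_succ' (n j : ℕ) : PP (n+1) (j+1) = j * PP n j := by
  unfold PP
  rw [Finset.prod_range_succ', mul_comm]
  congr 1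
  · push_cast; ring
  · apply Finset.prod_congr rfl
    intro i _
    push_cast; ring

lemma NI_zero (j : ℕ) : NI 0 j = 2 / (((j:ℝ)+2)*(j+3)*(j+4)) := by
  have h := intervalIntegral.integral_comp_sub_left (a := (0:ℝ)) (b := 1)
    (fun u : ℝ => (1-u)^2 * u^(j+1)) 1
  have e : NI 0 j = ∫ u in (0:ℝ)..1, (1-u)^2 * u^(j+1) := by
    simp only [sub_self, sub_zero] at h
    rw [← h]
    unfold NI
    simp [G]
  rw [e]
  have e2 : ∀ u : ℝ, (1-u)^2 * u^(j+1) = u^(j+1) - 2 * u^(j+2) + u^(j+3) := by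
    intro u; ring
  simp_rw [e2]
  rw [intervalIntegral.integral_add, intervalIntegral.integral_sub,
    intervalIntegral.integral_const_mul, integral_pow, integral_pow, integral_pow]
  · push_cast
    have h2 : (j:ℝ)+1+1 ≠ 0 := by positivity
    have h3 : (j:ℝ)+2+1 ≠ 0 := by positivity
    have h4 : (j:ℝ)+3+1 ≠ 0 := by positivity
    have h5 : (j:ℝ)+2 ≠ 0 := by positivity
    have h6 : (j:ℝ)+3 ≠ 0 := by positivity
    have h7 : (j:ℝ)+4 ≠ 0 := by positivity
    simp
    field_simp
    ring
  all_goals exact (Continuous.intervalIntegrable (by fun_prop) _ _)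

lemma NI_one (j : ℕ) : NI 1 j = NI 0 j / 2 - NI 0 (j+1) := by
  unfold NI
  rw [← intervalIntegral.integral_div, ← intervalIntegral.integral_sub]
  · congr 1; ext x; simp [G]; ring
  all_goals exact (Continuous.intervalIntegrable (by fun_prop) _ _)

lemma NI_rec (n j : ℕ) : NI (n+2) j = NI (n+1) j / 2 - NI (n+1) (j+1)
    - ((((n:ℝ)+1)*((n:ℝ)+5))/(4*(2*(n:ℝ)+5)*(2*(n:ℝ)+7))) * NI n j := by
  unfold NI
  rw [← intervalIntegral.integral_div, ← intervalIntegral.integral_const_mul,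
    ← intervalIntegral.integral_sub, ← intervalIntegral.integral_sub]
  · congr 1; ext x
    rw [show n+2+1 = n+3 from rfl, G]
    simp only [eval_sub, eval_mul, eval_X, eval_C]
    ring
  all_goals exact (Continuous.intervalIntegrable (by fun_prop) _ _)

noncomputable def FF (n j : ℕ) : ℝ :=
  (-1)^n * (n+4).factorial * (n+2).factorial / (2*n+4).factorial *
    ((j+1).factorial / (n+j+4).factorial) * PP n j

lemma FF_rec (n j : ℕ) : FF (n+2) j = FF (n+1) j / 2 - FF (n+1) (j+1)
    - ((((n:ℝ)+1)*((n:ℝ)+5))/(4*(2*(n:ℝ)+5)*(2*(n:ℝ)+7))) * FF n j := by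
  unfold FF
  rw [PP_succ', PP_succ, PP_succ]
  rw [show 2*(n+2)+4 = 2*n+4+1+1+1+1 by ring, show 2*(n+1)+4 = 2*n+4+1+1 by ring,
    show n+2+j+4 = n+j+4+1+1 by ring, show n+1+j+4 = n+j+4+1 by ring,
    show n+1+(j+1)+4 = n+j+4+1+1 by ring,
    show n+2+4 = n+4+1+1 by ring, show n+1+4 = n+4+1 by ring,
    show n+2+2 = n+2+1+1 by ring, show n+1+2 = n+2+1 by ring]
  simp only [Nat.factorial_succ (2*n+4+1+1+1), Nat.factorial_succ (2*n+4+1+1),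
    Nat.factorial_succ (2*n+4+1), Nat.factorial_succ (2*n+4), Nat.factorial_succ (n+j+4+1),
    Nat.factorial_succ (n+j+4), Nat.factorial_succ (n+4+1), Nat.factorial_succ (n+4),
    Nat.factorial_succ (n+2+1), Nat.factorial_succ (n+2), Nat.factorial_succ (j+1)]
  have a1 : ((2*n+4).factorial : ℝ) ≠ 0 := by positivity
  have a2 : ((n+j+4).factorial : ℝ) ≠ 0 := by positivity
  generalize ((2*n+4).factorial) = A at *
  generalize ((n+j+4).factorial) = B at *
  generalize ((n+4).factorial) = C
  generalize ((n+2).factorial) = D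
  generalize ((j+1).factorial) = E
  generalize PP n j = P
  push_cast
  have b1 : (2*(n:ℝ)+4+1+1+1+1) ≠ 0 := by positivity
  have b2 : (2*(n:ℝ)+4+1+1+1) ≠ 0 := by positivity
  have b3 : (2*(n:ℝ)+4+1+1) ≠ 0 := by positivity
  have b4 : (2*(n:ℝ)+4+1) ≠ 0 := by positivity
  have b5 : ((n:ℝ)+j+4+1+1) ≠ 0 := by positivity
  have b6 : ((n:ℝ)+j+4+1) ≠ 0 := by positivity
  have b7 : (2*(n:ℝ)+5) ≠ 0 := by positivity
  have b8 : (2*(n:ℝ)+7) ≠ 0 := by positivity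
  rw [pow_add, pow_add]
  field_simp
  ring

lemma FF_zero (j : ℕ) : FF 0 j = 2 / (((j:ℝ)+2)*(j+3)*(j+4)) := by
  unfold FF
  rw [show 0 + j + 4 = j+1+1+1+1 by ring]
  simp only [Nat.factorial_succ (j+1+1+1), Nat.factorial_succ (j+1+1), Nat.factorial_succ (j+1)]
  have a1 : ((j+1).factorial : ℝ) ≠ 0 := by positivity
  generalize ((j+1).factorial) = A at *
  have h2 : (j:ℝ)+1+1 ≠ 0 := by positivity
  have h3 : (j:ℝ)+1+1+1 ≠ 0 := by positivity
  have h4 : (j:ℝ)+1+1+1+1 ≠ 0 := by positivity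
  have h5 : (j:ℝ)+2 ≠ 0 := by positivity
  have h6 : (j:ℝ)+3 ≠ 0 := by positivity
  have h7 : (j:ℝ)+4 ≠ 0 := by positivity
  simp [PP, Nat.factorial]
  field_simp
  ring

lemma FF_one (j : ℕ) : FF 1 j = FF 0 j / 2 - FF 0 (j+1) := by
  rw [FF_zero, FF_zero]
  unfold FF
  rw [show 1 + j + 4 = j+1+1+1+1+1 by ring]
  simp only [Nat.factorial_succ (j+1+1+1+1), Nat.factorial_succ (j+1+1+1),
    Nat.factorial_succ (j+1+1), Nat.factorial_succ (j+1)]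
  have a1 : ((j+1).factorial : ℝ) ≠ 0 := by positivity
  generalize ((j+1).factorial) = A at *
  have h2 : (j:ℝ)+1+1 ≠ 0 := by positivity
  have h3 : (j:ℝ)+1+1+1 ≠ 0 := by positivity
  have h4 : (j:ℝ)+1+1+1+1 ≠ 0 := by positivity
  have h8 : (j:ℝ)+1+1+1+1+1 ≠ 0 := by positivity
  have h5 : (j:ℝ)+2 ≠ 0 := by positivity
  have h6 : (j:ℝ)+3 ≠ 0 := by positivity
  have h7 : (j:ℝ)+4 ≠ 0 := by positivity
  have h9 : (j:ℝ)+1+2 ≠ 0 := by positivity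
  have h10 : (j:ℝ)+1+3 ≠ 0 := by positivity
  have h11 : (j:ℝ)+1+4 ≠ 0 := by positivity
  simp [PP, Nat.factorial]
  field_simp
  ring

lemma NI_eq (n : ℕ) : (∀ j, NI n j = FF n j) ∧ (∀ j, NI (n+1) j = FF (n+1) j) := by
  induction n with
  | zero =>
    have h : ∀ j, NI 0 j = FF 0 j := fun j => by rw [NI_zero, FF_zero]
    refine ⟨h, fun j => ?_⟩
    rw [zero_add, NI_one, FF_one, h, h]
  | succ n ih =>
    refine ⟨ih.2, fun j => ?_⟩
    rw [NI_rec, FF_rec, ih.1, ih.2, ih.2]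

lemma PP_at_zero (n : ℕ) : PP n 0 = (-1)^n * n.factorial := by
  induction n with
  | zero => simp [PP]
  | succ n ih =>
    rw [PP_succ, ih, Nat.factorial_succ]
    push_cast
    ring

/-- ∫₀¹ x·ψ_k(x) dx = 1. -/
theorem psi_inner_x (k : ℕ) (hk : 1 ≤ k) :
    (∫ x in (0:ℝ)..1, x * (psi k).eval x) = 1 := by
  obtain ⟨n, rfl⟩ : ∃ n, k = n + 1 := ⟨k-1, by omega⟩
  have e : (∫ x in (0:ℝ)..1, x * (psi (n+1)).eval x) =
      ((Nat.factorial (2*n+4) : ℝ) /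
      ((Nat.factorial n : ℝ) * (Nat.factorial (n+2) : ℝ))) * NI n 0 := by
    unfold NI
    rw [← intervalIntegral.integral_const_mul]
    congr 1; ext x
    unfold psi
    rw [show 2*(n+1)+2 = 2*n+4 by ring, show n+1-1 = n by omega, show n+1+1 = n+2 by ring]
    simp only [eval_sub, eval_mul, eval_X, eval_C, eval_one]
    ring
  rw [e, (NI_eq n).1, FF, PP_at_zero, add_zero]
  have a1 : ((2*n+4).factorial : ℝ) ≠ 0 := by positivity
  have a2 : ((n+4).factorial : ℝ) ≠ 0 := by positivity
  have a3 : ((n+2).factorial : ℝ) ≠ 0 := by positivity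
  have a4 : (n.factorial : ℝ) ≠ 0 := by positivity
  have a5 : ((-1:ℝ)^n) * (-1)^n = 1 := by rw [← mul_pow]; simp
  simp only [zero_add, Nat.factorial_one, Nat.cast_one]
  field_simp
  linear_combination a5
end

section
/- For all integers q, p with 1 ≤ q ≤ p and all real numbers a₁, a₂, the finite sum identity ∑_{k=q}^{p−1} (2k+3)·(a₁ + (−1)^{k−1}a₂)² / (k(k+1)(k+2)(k+3)) = (1/(q(q+2)) − 1/(p(p+2)))·(a₁² + a₂²) + 2a₁a₂·((−1)^{q−1}/(q(q+1)(q+2)) − (−1)^{p−1}/(p(p+1)(p+2))) holds. -/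
/-- Finite sum identity used in the proof of the local inf–sup condition. -/
theorem sum_identity_q_to_p (q p : ℕ) (hq : 1 ≤ q) (hqp : q ≤ p) (a₁ a₂ : ℝ) :
    ∑ k ∈ Finset.Ico q p,
        (2*(k:ℝ)+3) * (a₁ + (-1:ℝ)^(k-1)*a₂)^2 / ((k:ℝ)*((k:ℝ)+1)*((k:ℝ)+2)*((k:ℝ)+3))
      = (1/((q:ℝ)*((q:ℝ)+2)) - 1/((p:ℝ)*((p:ℝ)+2))) * (a₁^2 + a₂^2)
        + 2*a₁*a₂ * ((-1:ℝ)^(q-1)/((q:ℝ)*((q:ℝ)+1)*((q:ℝ)+2))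
            - (-1:ℝ)^(p-1)/((p:ℝ)*((p:ℝ)+1)*((p:ℝ)+2))) := by
  induction p, hqp using Nat.le_induction with
  | base => simp
  | succ n hn ih =>
    rw [Finset.sum_Ico_succ_top hn, ih]
    obtain ⟨m, rfl⟩ : ∃ m, n = m + 1 := ⟨n - 1, by omega⟩
    have hm : (0:ℝ) ≤ (m:ℝ) := Nat.cast_nonneg m
    have h1 : (m:ℝ) + 1 ≠ 0 := by positivity
    have h2 : (m:ℝ) + 1 + 1 ≠ 0 := by positivity
    have h3 : (m:ℝ) + 1 + 2 ≠ 0 := by positivity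
    have h4 : (m:ℝ) + 1 + 3 ≠ 0 := by positivity
    have h5 : (m:ℝ) + 1 + 1 + 1 ≠ 0 := by positivity
    have h6 : (m:ℝ) + 1 + 1 + 2 ≠ 0 := by positivity
    simp only [Nat.add_sub_cancel, Nat.cast_add, Nat.cast_one, pow_succ (-1:ℝ) m]
    generalize (1:ℝ) / ((q:ℝ) * ((q:ℝ) + 2)) = A
    generalize (-1:ℝ)^(q-1) / ((q:ℝ) * ((q:ℝ) + 1) * ((q:ℝ) + 2)) = B
    rw [show (m:ℝ) + 1 + 1 + 1 = m + 1 + 2 by ring, show (m:ℝ) + 1 + 1 + 2 = m + 1 + 3 by ring]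
    rcases neg_one_pow_eq_or ℝ m with h | h <;> rw [h] <;>
    · generalize hx : (m:ℝ) + 1 = x at *
      field_simp
      ring
end

section
/- Let q and p be integers with q ≥ 1 and p ≥ q + 2, and set C²_{p,q} = 1 − (q+1)(q+2)/((p+1)(p+2)) if p + q is even and C²_{p,q} = 1 − (q+1)(q+2)/(p(p+1)) if p + q is odd. Then for every real polynomial μ of degree at most q, there exists a real polynomial v of degree at most p with v(0) = v(1) = 0 such that ∫₀¹ μ(x)·v(x) dx = ∫₀¹ v(x)² dx and ∫₀¹ v(x)² dx ≥ C²_{p,q} · ∫₀¹ μ(x)² dx. -/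
open Polynomial in
/-- integration over the unit interval -/
noncomputable def II (f : Polynomial ℝ) : ℝ := ∫ x in (0:ℝ)..1, f.eval x

theorem II_add (f g : Polynomial ℝ) : II (f + g) = II f + II g := by
  unfold II
  simp only [Polynomial.eval_add]
  exact intervalIntegral.integral_add (f.continuous.intervalIntegrable _ _)
    (g.continuous.intervalIntegrable _ _)

theorem II_smul (c : ℝ) (f : Polynomial ℝ) : II (Polynomial.C c * f) = c * II f := by
  unfold II
  simp only [Polynomial.eval_mul, Polynomial.eval_C]
  exact intervalIntegral.integral_const_mul _ _

theorem II_deriv (f : Polynomial ℝ) : II (Polynomial.derivative f) = f.eval 1 - f.eval 0 := by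
  unfold II
  exact intervalIntegral.integral_eq_sub_of_hasDerivAt (fun x _ => f.hasDerivAt x)
    (f.derivative.continuous.intervalIntegrable _ _)

theorem II_parts (f g : Polynomial ℝ) : II (Polynomial.derivative f * g) =
    f.eval 1 * g.eval 1 - f.eval 0 * g.eval 0 - II (f * Polynomial.derivative g) := by
  have h := II_deriv (f * g)
  rw [Polynomial.derivative_mul, II_add] at h
  simp only [Polynomial.eval_mul] at h
  linarith

theorem II_sq_nonneg (f : Polynomial ℝ) : 0 ≤ II (f * f) := by
  unfold II
  apply intervalIntegral.integral_nonneg (by norm_num)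
  intro x _
  rw [Polynomial.eval_mul]
  exact mul_self_nonneg _

open Polynomial in
theorem II_orth (f : ℝ[X]) (k : ℕ) : ∀ u : ℝ[X], X ^ k ∣ f → (1 - X) ^ k ∣ f → u.degree < k →
    II (derivative^[k] f * u) = 0 := by
  induction k with
  | zero =>
    intro u _ _ hu
    have : u = 0 := by
      rw [← degree_eq_bot]
      simpa using hu
    subst this
    simp [II]
  | succ k ih =>
    intro u h0 h1 hu
    rw [Function.iterate_succ_apply', II_parts]
    have e0 : (derivative^[k] f).eval 0 = 0 := by
      have := pow_sub_dvd_iterate_derivative_of_pow_dvd k h0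
      simp only [Nat.add_sub_cancel_left, pow_one] at this
      obtain ⟨r, hr⟩ := this
      rw [hr]; simp
    have e1 : (derivative^[k] f).eval 1 = 0 := by
      have := pow_sub_dvd_iterate_derivative_of_pow_dvd k h1
      simp only [Nat.add_sub_cancel_left, pow_one] at this
      obtain ⟨r, hr⟩ := this
      rw [hr]; simp
    rw [e0, e1, ih _ ((pow_dvd_pow _ (Nat.le_succ k)).trans h0)
      ((pow_dvd_pow _ (Nat.le_succ k)).trans h1)]
    · ring
    · by_cases hu0 : u = 0
      · subst hu0; simp [bot_lt_iff_ne_bot]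
      · have h2 := degree_derivative_lt hu0
        by_cases h3 : derivative u = 0
        · rw [h3]; simp [bot_lt_iff_ne_bot]
        · rw [degree_eq_natDegree h3] at h2 ⊢
          rw [degree_eq_natDegree hu0] at h2 hu
          norm_cast at *
          omega

open Polynomial in
/-- real shifted Legendre polynomial -/
noncomputable def PL (n : ℕ) : ℝ[X] := (shiftedLegendre n).map (Int.castRingHom ℝ)

open Polynomial in
theorem PL_symm (n : ℕ) : C ((-1) ^ n) * (PL n).comp (1 - X) = PL n := by
  have := congrArg (Polynomial.map (Int.castRingHom ℝ))
    (neg_one_pow_mul_shiftedLegendre_comp_one_sub_X_eq n)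
  simpa [PL, Polynomial.map_comp] using this

open Polynomial in
theorem PL_zero (n : ℕ) : (PL n).eval 0 = 1 := by
  rw [← coeff_zero_eq_eval_zero]
  simp [PL, coeff_shiftedLegendre]

open Polynomial in
theorem PL_one (n : ℕ) : (PL n).eval 1 = (-1) ^ n := by
  have := congrArg (eval 1) (PL_symm n)
  simp [PL_zero] at this
  exact this.symm

open Polynomial in
theorem PL_dzero (n : ℕ) : (derivative (PL n)).eval 0 = - (n * (n + 1)) := by
  rw [← coeff_zero_eq_eval_zero, coeff_derivative]
  simp [PL, coeff_shiftedLegendre]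

open Polynomial in
theorem PL_done (n : ℕ) : (derivative (PL n)).eval 1 = (-1) ^ n * (n * (n + 1)) := by
  have := congrArg (fun f => eval 1 (derivative f)) (PL_symm n)
  simp only [derivative_mul, derivative_comp, derivative_C] at this
  simp [PL_dzero] at this
  rw [← this]

open Polynomial in
theorem PL_deg (n : ℕ) : (PL n).natDegree ≤ n := by
  refine natDegree_map_le.trans ?_
  simp

open Polynomial in
theorem PL_orth (n : ℕ) (u : ℝ[X]) (hu : u.degree < n) : II (PL n * u) = 0 := by
  have h := congrArg (Polynomial.map (Int.castRingHom ℝ)) (factorial_mul_shiftedLegendre_eq n)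
  rw [← iterate_derivative_map] at h
  simp only [Polynomial.map_mul, Polynomial.map_natCast, Polynomial.map_pow, map_X,
    Polynomial.map_sub, Polynomial.map_one] at h
  have h2 := II_orth (X ^ n * (1 - X) ^ n) n u (dvd_mul_right _ _) (dvd_mul_left _ _) hu
  rw [← h] at h2
  change II (((n.factorial : ℕ) : ℝ[X]) * PL n * u) = 0 at h2
  rw [← C_eq_natCast, mul_assoc, II_smul] at h2
  exact (mul_eq_zero.1 h2).resolve_left (by positivity)

open Polynomial in
theorem PL_repr (n : ℕ) (u : ℝ[X]) (hu : u.natDegree ≤ n) :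
    II (derivative (PL n) * u) = (-1) ^ n * u.eval 1 - u.eval 0 := by
  rw [II_parts, PL_orth, PL_zero, PL_one]
  · ring
  · by_cases h3 : derivative u = 0
    · rw [h3]; simp [bot_lt_iff_ne_bot]
    · have hu0 : u ≠ 0 := by rintro rfl; simp at h3
      have h2 := degree_derivative_lt hu0
      rw [degree_eq_natDegree h3] at h2 ⊢
      rw [degree_eq_natDegree hu0] at h2
      norm_cast at *
      omega

open Polynomial in
theorem exists_w (n : ℕ) (hn : 1 ≤ n) (a b : ℝ) : ∃ w : ℝ[X], w.natDegree ≤ n ∧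
    w.eval 0 = a ∧ w.eval 1 = b ∧ ∀ u : ℝ[X], u.natDegree ≤ n →
      II (w * u) = ((-1) ^ n * b + a) * ((-1) ^ n * u.eval 1 + u.eval 0) / (2 * (n + 1) * (n + 2))
        + ((-1) ^ n * b - a) * ((-1) ^ n * u.eval 1 - u.eval 0) / (2 * n * (n + 1)) := by
  have hn' : (0 : ℝ) < n := by exact_mod_cast hn
  have hs : ((-1 : ℝ) ^ n) * (-1) ^ n = 1 := by
    rw [← mul_pow]; simp
  refine ⟨C (-((-1) ^ n * b + a) / (2 * (n + 1) * (n + 2))) * derivative (PL (n + 1)) +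
    C (((-1) ^ n * b - a) / (2 * n * (n + 1))) * derivative (PL n), ?_, ?_, ?_, ?_⟩
  · refine natDegree_add_le_of_degree_le ?_ ?_
    · refine (natDegree_C_mul_le _ _).trans ((natDegree_derivative_le _).trans ?_)
      have := PL_deg (n + 1)
      omega
    · refine (natDegree_C_mul_le _ _).trans ((natDegree_derivative_le _).trans ?_)
      have := PL_deg n
      omega
  · simp only [eval_add, eval_mul, eval_C, PL_dzero]
    push_cast
    field_simp
    ring
  · simp only [eval_add, eval_mul, eval_C, PL_done, pow_succ]
    push_cast
    generalize (-1 : ℝ) ^ n = s at *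
    field_simp
    linear_combination (2 * b * (n + 2)) * hs
  · intro u hu
    rw [add_mul, II_add, mul_assoc (C _), mul_assoc (C _), II_smul, II_smul, PL_repr _ _ hu,
      PL_repr _ _ (hu.trans (Nat.le_succ n)), pow_succ]
    ring

/-- Quantitative core of the proof of Theorem 4.1 on the unit interval. -/
theorem local_inf_sup_core (q p : ℕ) (hq : 1 ≤ q) (hp : q + 2 ≤ p)
    (μ : Polynomial ℝ) (hμ : μ.natDegree ≤ q) :
    ∃ v : Polynomial ℝ, v.natDegree ≤ p ∧ v.eval 0 = 0 ∧ v.eval 1 = 0 ∧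
      (∫ x in (0:ℝ)..1, μ.eval x * v.eval x) = (∫ x in (0:ℝ)..1, (v.eval x)^2) ∧
      (∫ x in (0:ℝ)..1, (v.eval x)^2)
        ≥ (if Even (p+q) then 1 - ((q:ℝ)+1)*((q:ℝ)+2)/(((p:ℝ)+1)*((p:ℝ)+2))
             else 1 - ((q:ℝ)+1)*((q:ℝ)+2)/((p:ℝ)*((p:ℝ)+1)))
            * (∫ x in (0:ℝ)..1, (μ.eval x)^2) := by
  have hμp : μ.natDegree ≤ p := by omega
  obtain ⟨w, hwd, hw0, hw1, hw⟩ := exists_w p (by omega) (μ.eval 0) (μ.eval 1)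
  obtain ⟨z, hzd, hz0, hz1, hz⟩ := exists_w q hq (μ.eval 0) (μ.eval 1)
  have hwμ := hw μ hμp
  have hww := hw w hwd
  have hzμ := hz μ hμ
  have hzz := hz z hzd
  rw [hw0, hw1, ← hwμ] at hww
  rw [hz0, hz1, ← hzμ] at hzz
  have key : ∀ y : Polynomial ℝ, II (y * y) = II (y * μ) →
      II ((μ + Polynomial.C (-1) * y) * (μ + Polynomial.C (-1) * y)) =
        II (μ * μ) - II (y * μ) := by
    intro y hy
    have : (μ + Polynomial.C (-1) * y) * (μ + Polynomial.C (-1) * y) =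
      μ * μ + (Polynomial.C (-1) * (y * μ) + (Polynomial.C (-1) * (y * μ) + y * y)) := by
      simp only [map_neg, map_one]; ring
    rw [this, II_add, II_add, II_add, II_smul, hy]; ring
  have kw := key w hww
  have kz := key z hzz
  have hpos := II_sq_nonneg (μ + Polynomial.C (-1) * z)
  rw [kz] at hpos
  have e1 : (∫ x in (0:ℝ)..1, (μ.eval x)^2) = II (μ * μ) := by
    simp only [II, Polynomial.eval_mul, sq]
  refine ⟨μ + Polynomial.C (-1) * w, ?_, ?_, ?_, ?_⟩
  · exact Polynomial.natDegree_add_le_of_degree_le hμp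
      ((Polynomial.natDegree_C_mul_le _ _).trans hwd)
  · simp [hw0]
  · simp [hw1]
  have e2 : (∫ x in (0:ℝ)..1, ((μ + Polynomial.C (-1) * w).eval x)^2) =
      II (μ * μ) - II (w * μ) := by
    rw [← kw]
    simp only [II, Polynomial.eval_mul, sq]
  have e3 : (∫ x in (0:ℝ)..1, μ.eval x * (μ + Polynomial.C (-1) * w).eval x) =
      II (μ * μ) - II (w * μ) := by
    have : II (μ * (μ + Polynomial.C (-1) * w)) = II (μ * μ) - II (w * μ) := by
      rw [show μ * (μ + Polynomial.C (-1) * w) = μ * μ + Polynomial.C (-1) * (w * μ) by ring,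
        II_add, II_smul]; ring
    rw [← this]
    simp only [II, Polynomial.eval_mul]
  rw [e1, e2, e3]
  refine ⟨rfl, ?_⟩
  have hq' : (1 : ℝ) ≤ q := by exact_mod_cast hq
  have hp' : (q : ℝ) + 2 ≤ p := by exact_mod_cast hp
  have hp0 : (0 : ℝ) < p := by linarith
  have hq0 : (0 : ℝ) < q := by linarith
  generalize II (μ * μ) = M at *
  have hzM : II (z * μ) ≤ M := by linarith
  suffices h : ∃ c, II (w * μ) ≤ c * II (z * μ) ∧ 0 ≤ c ∧ (if Even (p+q) then
      1 - ((q:ℝ)+1)*((q:ℝ)+2)/(((p:ℝ)+1)*((p:ℝ)+2))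
             else 1 - ((q:ℝ)+1)*((q:ℝ)+2)/((p:ℝ)*((p:ℝ)+1))) = 1 - c by
    obtain ⟨c, h1, h2, h3⟩ := h
    rw [h3]
    have := mul_le_mul_of_nonneg_left hzM h2
    linarith
  rw [hwμ, hzμ]
  by_cases hev : Even (p + q)
  · have hs : (-1 : ℝ) ^ p = (-1) ^ q := by
      have h1 : (-1 : ℝ) ^ (p + q) = 1 := hev.neg_one_pow
      rw [pow_add] at h1
      have h2 : (-1 : ℝ) ^ q * (-1) ^ q = 1 := by rw [← mul_pow]; simp
      linear_combination (-1) ^ q * h1 - (-1) ^ p * h2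
    refine ⟨_, ?_, ?_, if_pos hev⟩
    · rw [hs]
      generalize (-1 : ℝ) ^ q = s at *
      have A := mul_self_nonneg (s * μ.eval 1 + μ.eval 0)
      have B := mul_self_nonneg (s * μ.eval 1 - μ.eval 0)
      generalize (s * μ.eval 1 + μ.eval 0) * (s * μ.eval 1 + μ.eval 0) = α at *
      generalize (s * μ.eval 1 - μ.eval 0) * (s * μ.eval 1 - μ.eval 0) = β at *
      rw [mul_add _ (α / _)]
      apply add_le_add
      · apply le_of_eq; field_simp
      · rw [div_mul_div_comm, div_le_div_iff₀ (by positivity) (by positivity)]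
        have : (q : ℝ) * (p + 2) ≤ (q + 2) * p := by nlinarith
        have := mul_le_mul_of_nonneg_left this
          (show 0 ≤ β * (2 * (q + 1) * (p + 1)) by positivity)
        linarith
    · positivity
  · have hs : (-1 : ℝ) ^ p = -(-1) ^ q := by
      have h1 : (-1 : ℝ) ^ (p + q) = -1 := (Nat.not_even_iff_odd.1 hev).neg_one_pow
      rw [pow_add] at h1
      have h2 : (-1 : ℝ) ^ q * (-1) ^ q = 1 := by rw [← mul_pow]; simp
      linear_combination (-1) ^ q * h1 - (-1) ^ p * h2
    refine ⟨_, ?_, ?_, if_neg hev⟩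
    · rw [hs]
      generalize (-1 : ℝ) ^ q = s at *
      have A := mul_self_nonneg (s * μ.eval 1 + μ.eval 0)
      have B := mul_self_nonneg (s * μ.eval 1 - μ.eval 0)
      rw [show (-s * μ.eval 1 + μ.eval 0) * (-s * μ.eval 1 + μ.eval 0) =
          (s * μ.eval 1 - μ.eval 0) * (s * μ.eval 1 - μ.eval 0) by ring,
        show (-s * μ.eval 1 - μ.eval 0) * (-s * μ.eval 1 - μ.eval 0) =
          (s * μ.eval 1 + μ.eval 0) * (s * μ.eval 1 + μ.eval 0) by ring]
      generalize (s * μ.eval 1 + μ.eval 0) * (s * μ.eval 1 + μ.eval 0) = α at *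
      generalize (s * μ.eval 1 - μ.eval 0) * (s * μ.eval 1 - μ.eval 0) = β at *
      rw [add_comm (β / _), mul_add _ (α / _)]
      apply add_le_add
      · apply le_of_eq; field_simp
      · rw [div_mul_div_comm, div_le_div_iff₀ (by positivity) (by positivity)]
        have : (q : ℝ) * p ≤ (q + 2) * (p + 2) := by nlinarith
        have := mul_le_mul_of_nonneg_left this
          (show 0 ≤ β * (2 * (q + 1) * (p + 1)) by positivity)
        linarith
    · positivity
end
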